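/- arXiv:1505.07025 — 5 statements merged into one kernel-verified Lean document; each statement's English description precedes it below -/
import Mathlib

section
/- Let C be a nonzero subcategory of mod A closed under kernels of epimorphisms, and M ∈ mod A, n ≥ 0. Then Extⁿ_A(N, M) = 0 for all N ∈ C if and only if Extⁿ_A(N, M) = 0 for all N ∈ C̄. -/
open CategoryTheory

variable {A : Type} [Ring A]

/-- `C̲`: the nonzero modules of `C` none of whose proper nonzero submodules lies in `C`. -/
def subMin (C : Set (ModuleCat A)) : Set (ModuleCat A) :=
  {M | M ∈ C ∧ Nontrivial M ∧
    ∀ L : Submodule A M, L ≠ ⊥ → L ≠ ⊤ → ModuleCat.of A L ∉ C}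

/-- `C̄`: the nonzero modules of `C` none of whose proper nonzero quotients lies in `C`. -/
def quotMin (C : Set (ModuleCat A)) : Set (ModuleCat A) :=
  {M | M ∈ C ∧ Nontrivial M ∧
    ∀ L : Submodule A M, L ≠ ⊥ → L ≠ ⊤ → ModuleCat.of A (M ⧸ L) ∉ C}

lemma ext_iff_aux (N M : ModuleCat.{0} A) (n : ℕ) :
    Subsingleton (((Ext ℤ (ModuleCat A) n).obj (Opposite.op N)).obj M) ↔
      Subsingleton (Abelian.Ext N M n) := by
  let P := ProjectiveResolution.of N
  have h1 : Subsingleton (((Ext ℤ (ModuleCat A) n).obj (Opposite.op N)).obj M) ↔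
      (P.complex.linearYonedaObj ℤ M).ExactAt n := by
    rw [HomologicalComplex.exactAt_iff_isZero_homology, ← (P.isoExt n M).isZero_iff]
    exact (ModuleCat.isZero_iff_subsingleton).symm
  rw [h1]
  rcases n with _ | n
  · rw [HomologicalComplex.exactAt_iff' _ 0 0 1 (by simp) (by simp),
      ShortComplex.moduleCat_exact_iff]
    have h2 : (∀ f : P.complex.X 0 ⟶ M, P.complex.d 1 0 ≫ f = 0 →
        ∃ g : P.complex.X 0 ⟶ M, P.complex.d 0 0 ≫ g = f) ↔ Subsingleton (Abelian.Ext N M 0) := by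
      rw [Abelian.Ext.homEquiv₀.subsingleton_congr]
      have h00 : P.complex.d 0 0 = 0 := P.complex.shape _ _ (by simp)
      constructor
      · intro h
        refine subsingleton_of_forall_eq 0 fun g => ?_
        have key : ∀ g' : ((ChainComplex.single₀ (ModuleCat A)).obj N).X 0 ⟶ M, g' = 0 := by
          intro g'
          obtain ⟨k, hk⟩ := h (P.π.f 0 ≫ g') (by
            rw [← Category.assoc, P.complex_d_comp_π_f_zero, Limits.zero_comp])
          rw [h00, Limits.zero_comp] at hk
          rw [← cancel_epi (P.π.f 0), ← hk, Limits.comp_zero]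
        exact key g
      · intro h f hf
        refine ⟨0, ?_⟩
        have h3 := P.isColimitCokernelCofork.fac (Limits.CokernelCofork.ofπ f hf)
          Limits.WalkingParallelPair.one
        have h4 : P.isColimitCokernelCofork.desc (Limits.CokernelCofork.ofπ f hf) = 0 :=
          h.elim _ _
        rw [h4, Limits.comp_zero] at h3
        rw [Limits.comp_zero]
        exact h3
    exact h2
  · rw [HomologicalComplex.exactAt_iff' _ n (n+1) (n+2) (by simp) (by simp),
      ShortComplex.moduleCat_exact_iff]
    have h2 : (∀ f : P.complex.X (n+1) ⟶ M, P.complex.d (n+2) (n+1) ≫ f = 0 →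
        ∃ g : P.complex.X n ⟶ M, P.complex.d (n+1) n ≫ g = f) ↔
          Subsingleton (Abelian.Ext N M (n+1)) := by
      constructor
      · intro h
        refine subsingleton_of_forall_eq 0 fun x => ?_
        obtain ⟨f, hf, rfl⟩ := P.extMk_surjective x (n+2) rfl
        rw [P.extMk_eq_zero_iff f (n+2) rfl hf n rfl]
        exact h f hf
      · intro h f hf
        rw [← P.extMk_eq_zero_iff f (n+2) rfl hf n rfl]
        exact h.elim _ _
    exact h2

lemma ext_mid_aux (N M : ModuleCat.{0} A) (L : Submodule A N) (n : ℕ)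
    (h1 : Subsingleton (Abelian.Ext (ModuleCat.of A L) M n))
    (h3 : Subsingleton (Abelian.Ext (ModuleCat.of A (N ⧸ L)) M n)) :
    Subsingleton (Abelian.Ext N M n) := by
  let S : ShortComplex (ModuleCat.{0} A) :=
    ShortComplex.mk (X₁ := ModuleCat.of A L) (X₂ := N) (X₃ := ModuleCat.of A (N ⧸ L))
      (ModuleCat.ofHom L.subtype) (ModuleCat.ofHom L.mkQ) (by ext x; simp)
  have hS : S.ShortExact :=
    { exact := by
        rw [ShortComplex.moduleCat_exact_iff]
        intro x hx
        exact ⟨⟨x, (Submodule.Quotient.mk_eq_zero L).1 hx⟩, rfl⟩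
      mono_f := (ModuleCat.mono_iff_injective _).2 L.subtype_injective
      epi_g := (ModuleCat.epi_iff_surjective _).2 L.mkQ_surjective }
  refine subsingleton_of_forall_eq 0 fun x => ?_
  obtain ⟨y, hy⟩ := Abelian.Ext.contravariant_sequence_exact₂ hS M x (h1.elim _ _)
  rw [← hy, (h3.elim y 0 : y = 0), Abelian.Ext.comp_zero]

lemma main_aux [IsArtinianRing A] (C : Set (ModuleCat.{0} A))
    (hfg : ∀ N ∈ C, Module.Finite A N)
    (hker : ∀ (M N : ModuleCat A), M ∈ C → N ∈ C → ∀ f : M →ₗ[A] N,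
      Function.Surjective f → ModuleCat.of A (LinearMap.ker f) ∈ C)
    (M : ModuleCat A) (n : ℕ)
    (h : ∀ N ∈ quotMin C, Subsingleton (Abelian.Ext N M n)) (k : ℕ∞) :
    ∀ N ∈ C, Module.length A N = k → Subsingleton (Abelian.Ext N M n) := by
  induction k using WellFoundedLT.induction with
  | _ k ih =>
  rintro N hN rfl
  have := hfg N hN
  by_cases hN0 : Nontrivial N
  · by_cases hq : N ∈ quotMin C
    · exact h N hq
    · have : ∃ L : Submodule A N, L ≠ ⊥ ∧ L ≠ ⊤ ∧ ModuleCat.of A (N ⧸ L) ∈ C := by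
        by_contra! hcon
        exact hq ⟨hN, hN0, hcon⟩
      obtain ⟨L, hb, ht, hL⟩ := this
      have hL' : ModuleCat.of A L ∈ C := by
        have := hker N (ModuleCat.of A (N ⧸ L)) hN hL L.mkQ L.mkQ_surjective
        rwa [Submodule.ker_mkQ] at this
      exact ext_mid_aux N M L n (ih _ (Submodule.length_lt ht) _ hL' rfl)
        (ih _ (Submodule.length_quotient_lt L hb) _ hL rfl)
  · rw [not_nontrivial_iff_subsingleton] at hN0
    have hz : 𝟙 N = 0 := (ModuleCat.isZero_of_subsingleton N).eq_of_src _ _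
    refine subsingleton_of_forall_eq 0 fun x => ?_
    rw [← Abelian.Ext.mk₀_id_comp x, hz, Abelian.Ext.mk₀_zero, Abelian.Ext.zero_comp]

/-- If `C` is a nonzero subcategory of `mod A` (`A` artinian) closed under kernels of
epimorphisms, then for any module `M` and any `n ≥ 0`, `Extⁿ_A(N, M) = 0` for all `N ∈ C`
if and only if `Extⁿ_A(N, M) = 0` for all `N ∈ C̄`. -/
theorem stmt_7 [IsArtinianRing A] (C : Set (ModuleCat A))
    (hC : ∃ N ∈ C, Nontrivial N)
    (hfg : ∀ N ∈ C, Module.Finite A N)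
    (hker : ∀ (M N : ModuleCat A), M ∈ C → N ∈ C → ∀ f : M →ₗ[A] N,
      Function.Surjective f → ModuleCat.of A (LinearMap.ker f) ∈ C)
    (M : ModuleCat A) (n : ℕ) :
    (∀ N ∈ C, Subsingleton (((Ext ℤ (ModuleCat A) n).obj (Opposite.op N)).obj M))
      ↔ (∀ N ∈ quotMin C,
          Subsingleton (((Ext ℤ (ModuleCat A) n).obj (Opposite.op N)).obj M)) := by
  simp only [ext_iff_aux]
  exact ⟨fun h N hN => h N hN.1, fun h N hN => main_aux C hfg hker M n h _ N hN rfl⟩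
end

section
/- Let C be a nonzero subcategory of mod A closed under extensions and kernels of epimorphisms. Then C̄ is the smallest class of modules X with F(X) = C: every nonzero module in C has a C̄-filtration, every C̄-filtered module lies in C, and any class X ⊆ C filtering C contains C̄. -/
open CategoryTheory

variable {A : Type} [Ring A]

/-- `M` is `X`-filtered: there is a chain `0 = M₀ ⊂ M₁ ⊂ ⋯ ⊂ Mₙ = M` of submodules
with all successive quotients in `X`. -/
def Filtered (X : Set (ModuleCat A)) (M : ModuleCat A) : Prop :=
  ∃ (n : ℕ) (s : Fin (n+1) → Submodule A M),
    s 0 = ⊥ ∧ s (Fin.last n) = ⊤ ∧ StrictMono s ∧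
    ∀ i : Fin n, ModuleCat.of A
      (↥(s i.succ) ⧸ (s i.castSucc).comap (s i.succ).subtype) ∈ X

/-- `M` is `X`-cofiltered: there is a sequence of proper surjections
`M = Mₙ → Mₙ₋₁ → ⋯ → M₀ = 0` with all kernels in `X`. -/
def Cofiltered (X : Set (ModuleCat A)) (M : ModuleCat A) : Prop :=
  ∃ (n : ℕ) (N : Fin (n+1) → ModuleCat A)
    (f : ∀ i : Fin n, N i.succ →ₗ[A] N i.castSucc),
    N (Fin.last n) = M ∧ Subsingleton (N 0) ∧
    ∀ i : Fin n, Function.Surjective (f i) ∧ ¬ Function.Injective (f i) ∧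
      ModuleCat.of A (LinearMap.ker (f i)) ∈ X

/-- A chain from `⊥` to `P` in the submodules of `M` with factors in `X`. -/
def ChainTo (X : Set (ModuleCat A)) (M : ModuleCat A) (P : Submodule A M) : Prop :=
  ∃ (n : ℕ) (s : Fin (n+1) → Submodule A M),
    s 0 = ⊥ ∧ s (Fin.last n) = P ∧ StrictMono s ∧
    ∀ i : Fin n, ModuleCat.of A
      (↥(s i.succ) ⧸ (s i.castSucc).comap (s i.succ).subtype) ∈ X

theorem ChainTo.step {X : Set (ModuleCat A)} {M : ModuleCat A} {L P : Submodule A M}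
    (h : ChainTo X M L) (hLP : L < P)
    (hX : ModuleCat.of A (↥P ⧸ L.comap P.subtype) ∈ X) : ChainTo X M P := by
  obtain ⟨n, s, h0, hl, hs, hq⟩ := h
  refine ⟨n + 1, Fin.snoc (α := fun _ => Submodule A M) s P, ?_, ?_, ?_, ?_⟩
  · rw [← Fin.castSucc_zero, Fin.snoc_castSucc, h0]
  · simp
  · rw [Fin.strictMono_iff_lt_succ]
    intro i
    refine Fin.lastCases ?_ (fun j => ?_) i
    · rw [Fin.snoc_castSucc, Fin.succ_last, Fin.snoc_last, hl]
      exact hLP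
    · rw [Fin.snoc_castSucc, Fin.succ_castSucc, Fin.snoc_castSucc]
      exact hs (Fin.castSucc_lt_succ)
  · intro i
    refine Fin.lastCases ?_ (fun j => ?_) i
    · rw [Fin.snoc_castSucc, Fin.succ_last, Fin.snoc_last, hl]
      exact hX
    · rw [Fin.snoc_castSucc, Fin.succ_castSucc, Fin.snoc_castSucc]
      exact hq j

/-- Quotient of a quotient as a single quotient. -/
noncomputable def quotQuotEquiv {N : Type*} [AddCommGroup N] [Module A N] (L : Submodule A N)
    (K : Submodule A (N ⧸ L)) : ((N ⧸ L) ⧸ K) ≃ₗ[A] (N ⧸ K.comap L.mkQ) :=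
  ((Submodule.quotEquivOfEq (K.comap L.mkQ) (LinearMap.ker (K.mkQ ∘ₗ L.mkQ))
    (by rw [LinearMap.ker_comp, Submodule.ker_mkQ])).trans
    (LinearMap.quotKerEquivOfSurjective (K.mkQ ∘ₗ L.mkQ)
      ((Submodule.mkQ_surjective K).comp (Submodule.mkQ_surjective L)))).symm

/-- If `C` is a nonzero subcategory of `mod A` (`A` artinian) closed under extensions and
kernels of epimorphisms, then `C̄` is the smallest class of modules filtering `C`:
every nonzero module of `C` is `C̄`-filtered, every nonzero `C̄`-filtered module lies in `C`,
and every class `X ⊆ C` that filters `C` contains `C̄`. -/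
theorem stmt_9 [IsArtinianRing A] (C : Set (ModuleCat A))
    (hC : ∃ N ∈ C, Nontrivial N)
    (hfg : ∀ N ∈ C, Module.Finite A N)
    (hiso : ∀ M N : ModuleCat A, (M ≃ₗ[A] N) → M ∈ C → N ∈ C)
    (hext : ∀ (M : ModuleCat A) (L : Submodule A M),
      ModuleCat.of A L ∈ C → ModuleCat.of A (M ⧸ L) ∈ C → M ∈ C)
    (hker : ∀ (M N : ModuleCat A), M ∈ C → N ∈ C → ∀ f : M →ₗ[A] N,
      Function.Surjective f → ModuleCat.of A (LinearMap.ker f) ∈ C) :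
    (∀ M ∈ C, Nontrivial M → Filtered (quotMin C) M) ∧
    (∀ M : ModuleCat A, Nontrivial M → Filtered (quotMin C) M → M ∈ C) ∧
    (∀ X ⊆ C, (∀ M N : ModuleCat A, (M ≃ₗ[A] N) → M ∈ X → N ∈ X) →
      (∀ M ∈ C, Nontrivial M → Filtered X M) → quotMin C ⊆ X) := by
  have zero_mem : ∀ N : ModuleCat A, Subsingleton N → N ∈ C := by
    intro N hN
    obtain ⟨N', hN', -⟩ := hC
    have := hker N' N' hN' hN' LinearMap.id Function.surjective_id
    have hss : Subsingleton (LinearMap.ker (LinearMap.id : N' →ₗ[A] N')) := by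
      rw [LinearMap.ker_id]; infer_instance
    exact hiso (ModuleCat.of A (LinearMap.ker (LinearMap.id : N' →ₗ[A] N'))) N
      (show (LinearMap.ker (LinearMap.id : N' →ₗ[A] N')) ≃ₗ[A] N from 0) this
  refine ⟨?_, ?_, ?_⟩
  · intro M hM _
    have := hfg M hM
    have key : ∀ P : Submodule A M, ModuleCat.of A P ∈ C → ChainTo (quotMin C) M P := by
      intro P
      induction P using WellFoundedLT.induction with
      | ind P ih =>
      intro hP
      by_cases hbot : P = ⊥
      · subst hbot
        exact ⟨0, fun _ => ⊥, rfl, rfl, fun a b h => by omega, fun i => i.elim0⟩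
      let S : Set (Submodule A M) :=
        {L | L < P ∧ ModuleCat.of A (↥P ⧸ L.comap P.subtype) ∈ C}
      have hS : S.Nonempty := by
        refine ⟨⊥, bot_lt_iff_ne_bot.mpr hbot, ?_⟩
        refine hiso (ModuleCat.of A P) _ ?_ hP
        exact (Submodule.quotEquivOfEqBot _ (by
          rw [Submodule.comap_bot, Submodule.ker_subtype])).symm
      obtain ⟨L, ⟨hLP, hLC⟩, hmax⟩ := WellFounded.has_min
        (wellFounded_gt : WellFounded (fun a b : Submodule A M => a > b)) S hS
      have hL : ModuleCat.of A L ∈ C := by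
        have h1 := hker (ModuleCat.of A P) _ hP hLC (L.comap P.subtype).mkQ
          (Submodule.mkQ_surjective _)
        refine hiso _ _ ?_ h1
        exact (LinearEquiv.ofEq _ _ (Submodule.ker_mkQ _)).trans
          (Submodule.comapSubtypeEquivOfLe hLP.le)
      refine (ih L hLP hL).step hLP ⟨hLC, ?_, ?_⟩
      · refine Submodule.Quotient.nontrivial_iff.mpr ?_
        intro h
        rw [Submodule.comap_subtype_eq_top] at h
        exact absurd hLP (not_lt_of_ge h)
      · intro K hK0 hK1 hKC
        let K' : Submodule A P := Submodule.comap (L.comap P.subtype).mkQ K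
        have hK'c : (K'.map P.subtype).comap P.subtype = K' :=
          Submodule.comap_map_eq_of_injective P.injective_subtype K'
        have hLK : L.comap P.subtype ≤ K' := Submodule.le_comap_mkQ _ K
        have hmapK : K'.map (L.comap P.subtype).mkQ = K :=
          Submodule.map_comap_eq_of_surjective (Submodule.mkQ_surjective _) K
        refine hmax (K'.map P.subtype) ⟨?_, ?_⟩ ?_
        · refine lt_of_le_of_ne (Submodule.map_subtype_le P K') fun h => hK1 ?_
          rw [h, Submodule.comap_subtype_self] at hK'c
          rw [← hmapK, ← hK'c, Submodule.map_top, Submodule.range_mkQ]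
        · rw [hK'c]
          exact hiso _ _ (quotQuotEquiv (L.comap P.subtype) K) hKC
        · refine lt_of_le_of_ne ?_ fun h => hK0 ?_
          · intro x hx
            exact ⟨⟨x, hLP.le hx⟩, hLK hx, rfl⟩
          · rw [← h] at hK'c
            rw [← hmapK, ← hK'c, Submodule.mkQ_map_self]
    exact key ⊤ (hiso M _ Submodule.topEquiv.symm hM)
  · rintro M _ ⟨n, s, h0, hl, hs, hq⟩
    have key : ∀ i : Fin (n+1), ModuleCat.of A (s i) ∈ C := by
      intro i
      induction i using Fin.induction with
      | zero =>
        rw [h0]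
        exact zero_mem _ (inferInstanceAs (Subsingleton (⊥ : Submodule A M)))
      | succ i ih =>
        refine hext (ModuleCat.of A (s i.succ)) ((s i.castSucc).comap (s i.succ).subtype) ?_
          (hq i).1
        refine hiso _ _ ?_ ih
        exact (Submodule.comapSubtypeEquivOfLe (hs Fin.castSucc_lt_succ).le).symm
    have := key (Fin.last n)
    rw [hl] at this
    exact hiso _ _ Submodule.topEquiv this
  · rintro X hX hXiso hfil M ⟨hM, hMn, hmin⟩
    obtain ⟨n, s, h0, hl, hs, hq⟩ := hfil M hM hMn
    cases n with
    | zero =>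
      exact absurd (h0.symm.trans hl) bot_ne_top
    | succ m =>
      have hlast := hq (Fin.last m)
      have hlt : s (Fin.last m).castSucc < ⊤ := by
        rw [← hl]; exact hs (Fin.castSucc_lt_last _)
      rw [Fin.succ_last, hl] at hlast
      generalize s (Fin.last m).castSucc = L at hlast hlt
      have e : (↥(⊤ : Submodule A M) ⧸ L.comap (⊤ : Submodule A M).subtype) ≃ₗ[A] (M ⧸ L) :=
        Submodule.Quotient.equiv _ _ Submodule.topEquiv (by
          ext x
          simp)
      have hLX : ModuleCat.of A (M ⧸ L) ∈ X := hXiso _ _ e hlast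
      by_cases hb : L = ⊥
      · exact hXiso _ _ (Submodule.quotEquivOfEqBot L hb) hLX
      · exact absurd (hX hLX) (hmin L hb hlt.ne)
end

section
/- Let C be a nonzero subcategory of mod A containing 0 and closed under extensions and submodules. Then C is closed under quotients if and only if C̄ ⊆ C̲; and in that case C̄ = C̲ and both equal the set of simple modules in C. -/
open CategoryTheory

variable {A : Type} [Ring A]

/-- Let `C` be a nonzero subcategory of `mod A` (`A` artinian) containing the zero module,
closed under isomorphism, extensions and submodules.  Then `C` is closed under quotients
iff `C̄ ⊆ C̲`; and in that case `C̄ = C̲` and both equal the set of simple modules in `C`. -/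
theorem stmt_13 [IsArtinianRing A] (C : Set (ModuleCat A))
    (hC : ∃ N ∈ C, Nontrivial N)
    (hzero : ∀ M : ModuleCat A, Subsingleton M → M ∈ C)
    (hfg : ∀ N ∈ C, Module.Finite A N)
    (hiso : ∀ M N : ModuleCat A, (M ≃ₗ[A] N) → M ∈ C → N ∈ C)
    (hext : ∀ (M : ModuleCat A) (L : Submodule A M),
      ModuleCat.of A L ∈ C → ModuleCat.of A (M ⧸ L) ∈ C → M ∈ C)
    (hsub : ∀ M ∈ C, ∀ L : Submodule A M, ModuleCat.of A L ∈ C) :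
    ((∀ M ∈ C, ∀ (N : ModuleCat A) (f : M →ₗ[A] N), Function.Surjective f → N ∈ C)
        ↔ quotMin C ⊆ subMin C) ∧
    (quotMin C ⊆ subMin C →
      quotMin C = subMin C ∧
      quotMin C = {M : ModuleCat A | M ∈ C ∧ IsSimpleModule A M}) := by
  have hsimp : ∀ M : ModuleCat A, M ∈ C → IsSimpleModule A M → M ∈ quotMin C ∧ M ∈ subMin C := by
    intro M hM hs
    have hn : Nontrivial M := IsSimpleModule.nontrivial A M
    refine ⟨⟨hM, hn, ?_⟩, ⟨hM, hn, ?_⟩⟩ <;>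
    · intro L h1 h2
      rcases eq_bot_or_eq_top L with h | h
      · exact absurd h h1
      · exact absurd h h2
  have hss : ∀ M : ModuleCat A, M ∈ subMin C → IsSimpleModule A M := by
    rintro M ⟨hM, hn, h⟩
    rw [isSimpleModule_iff]
    refine { eq_bot_or_eq_top := fun L => ?_ }
    by_contra! hc
    exact h L hc.1 hc.2 (hsub M hM L)
  have key : quotMin C ⊆ subMin C → ∀ n : ℕ∞, ∀ M ∈ C, Module.length A M = n →
      ∀ (N : ModuleCat A) (f : M →ₗ[A] N), Function.Surjective f → N ∈ C := by
    intro hqs n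
    induction n using WellFoundedLT.induction with
    | ind n ih =>
    intro M hM hn N f hf
    have hfin := hfg M hM
    by_cases hNt : Subsingleton N
    · exact hzero N hNt
    have hNn : Nontrivial N := not_subsingleton_iff_nontrivial.mp hNt
    have hMn : Nontrivial M := hf.nontrivial
    by_cases hq : M ∈ quotMin C
    · have hs := hss M (hqs hq)
      have hinj : Function.Injective f := by
        rcases LinearMap.injective_or_eq_zero f with h | h
        · exact h
        · exfalso
          obtain ⟨y, hy⟩ := exists_ne (0 : N)
          obtain ⟨x, rfl⟩ := hf y
          simp [h] at hy
      exact hiso M N (LinearEquiv.ofBijective f ⟨hinj, hf⟩) hM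
    · have : ∃ L : Submodule A M, L ≠ ⊥ ∧ L ≠ ⊤ ∧ ModuleCat.of A (M ⧸ L) ∈ C := by
        by_contra! hc
        exact hq ⟨hM, hMn, hc⟩
      obtain ⟨L, h1, h2, h3⟩ := this
      have hl1 : Module.length A L < n := hn ▸ Submodule.length_lt h2
      have hl2 : Module.length A (M ⧸ L) < n := hn ▸ Submodule.length_quotient_lt L h1
      refine hext N (L.map f) ?_ ?_
      · exact ih _ hl1 (ModuleCat.of A L) (hsub M hM L) rfl (ModuleCat.of A (L.map f))
          (f.submoduleMap L) (f.submoduleMap_surjective L)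
      · refine ih _ hl2 (ModuleCat.of A (M ⧸ L)) h3 rfl (ModuleCat.of A (N ⧸ L.map f))
          (L.mapQ (L.map f) f (Submodule.le_comap_map f L)) ?_
        intro y
        obtain ⟨y, rfl⟩ := Submodule.mkQ_surjective _ y
        obtain ⟨x, rfl⟩ := hf y
        exact ⟨Submodule.Quotient.mk x, rfl⟩
  refine ⟨⟨?_, fun h M hM N f hf => key h _ M hM rfl N f hf⟩, fun h => ⟨?_, ?_⟩⟩
  · rintro h M ⟨hM, hn, hq⟩
    refine (hsimp M hM ?_).2
    rw [isSimpleModule_iff]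
    refine { eq_bot_or_eq_top := fun L => ?_ }
    by_contra! hc
    exact hq L hc.1 hc.2 (h M hM (ModuleCat.of A (M ⧸ L)) L.mkQ L.mkQ_surjective)
  · exact h.antisymm fun M hM => (hsimp M hM.1 (hss M hM)).1
  · ext M
    exact ⟨fun hM => ⟨hM.1, hss M (h hM)⟩, fun hM => (hsimp M hM.1 hM.2).1⟩
end

section
/- Let {0} ≠ C₀ ⊆ C₁ ⊆ ⋯ ⊆ mod A satisfy (G3) (extension-closedness: L ∈ C_l and N ∈ C_n implies M ∈ C_{max(l,n)} for any short exact sequence 0 → L → M → N → 0) and (G1). For m ≥ n ≥ 1, the following are equivalent: (a) Cₙ = C_m; (b) C̄_m ⊆ Cₙ; (c) C̲_m ⊆ Cₙ. -/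
open CategoryTheory

variable {A : Type} [Ring A]

theorem length_induct_aux [IsArtinianRing A] (P Q : ModuleCat A → Prop)
    (hfg : ∀ M, P M → Module.Finite A M)
    (step : ∀ M, P M → (∀ N, P N → Module.length A N < Module.length A M → Q N) → Q M) :
    ∀ M, P M → Q M := by
  intro M hM
  induction h : Module.length A M using WellFoundedLT.induction generalizing M with
  | ind x ih =>
    subst h
    exact step M hM fun N hN hlt => ih _ hlt N hN rfl

theorem length_sub_quot_aux [IsArtinianRing A] (M : ModuleCat A) [Module.Finite A M]
    (L : Submodule A M) (h1 : L ≠ ⊥) (h2 : L ≠ ⊤) :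
    Module.length A L < Module.length A M ∧ Module.length A (M ⧸ L) < Module.length A M := by
  have hfin : Module.length A M ≠ ⊤ := Module.length_ne_top
  refine ⟨Submodule.length_lt h2, ?_⟩
  rw [Module.length_quotient, Module.length_eq_coheight]
  refine Order.coheight_strictAnti h1.bot_lt ?_
  rw [← Module.length_quotient]
  exact Module.length_ne_top.lt_top

/-- If `{0} ≠ C₀ ⊆ C₁ ⊆ ⋯ ⊆ mod A` satisfies (G3) (extension-closedness) and (G1), then
for `m ≥ n ≥ 1` the following are equivalent: (a) `Cₙ = C_m`; (b) `C̄_m ⊆ Cₙ`;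
(c) `C̲_m ⊆ Cₙ`. -/
theorem stmt_16 [IsArtinianRing A] (C : ℕ → Set (ModuleCat A))
    (h0 : ∃ N ∈ C 0, Nontrivial N)
    (hfg : ∀ k, ∀ N ∈ C k, Module.Finite A N)
    (hiso : ∀ k, ∀ M N : ModuleCat A, (M ≃ₗ[A] N) → M ∈ C k → N ∈ C k)
    (hmono : ∀ k, C k ⊆ C (k+1))
    (hG1a : ∀ (L M N : ModuleCat A) (f : L →ₗ[A] M) (g : M →ₗ[A] N),
      Function.Injective f → Function.Surjective g → LinearMap.ker g = LinearMap.range f →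
      ∀ l m, L ∈ C l → M ∈ C m → N ∈ C (max (l+1) m))
    (hG1b : ∀ (L M N : ModuleCat A) (f : L →ₗ[A] M) (g : M →ₗ[A] N),
      Function.Injective f → Function.Surjective g → LinearMap.ker g = LinearMap.range f →
      ∀ m k, M ∈ C m → N ∈ C k → L ∈ C (max m (k-1)))
    (hG3 : ∀ (L M N : ModuleCat A) (f : L →ₗ[A] M) (g : M →ₗ[A] N),
      Function.Injective f → Function.Surjective g → LinearMap.ker g = LinearMap.range f →
      ∀ l k, L ∈ C l → N ∈ C k → M ∈ C (max l k))
    (m n : ℕ) (hn : 1 ≤ n) (hnm : n ≤ m) :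
    (C n = C m ↔ quotMin (C m) ⊆ C n) ∧ (C n = C m ↔ subMin (C m) ⊆ C n) := by
  have mono : ∀ a b, a ≤ b → C a ⊆ C b := fun a b h => (monotone_nat_of_le_succ hmono) h
  have hz : ∀ M : ModuleCat A, Subsingleton M → M ∈ C 0 := by
    intro M hM
    obtain ⟨N, hN, -⟩ := h0
    have := hG1b M N N 0 LinearMap.id (Function.injective_of_subsingleton _)
      Function.surjective_id (by simp) 0 0 hN hN
    simpa using this
  have e1 : ∀ (M : ModuleCat A) (L : Submodule A M), LinearMap.ker L.mkQ = LinearMap.range L.subtype := by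
    intro M L; simp
  have ext : ∀ (M : ModuleCat A) (L : Submodule A M), ModuleCat.of A L ∈ C n →
      ModuleCat.of A (M ⧸ L) ∈ C n → M ∈ C n := by
    intro M L hL hQ
    simpa using hG3 (ModuleCat.of A L) M (ModuleCat.of A (M ⧸ L)) L.subtype L.mkQ
      L.injective_subtype L.mkQ_surjective (e1 M L) n n hL hQ
  refine ⟨⟨fun h M hM => h ▸ hM.1, fun h => (mono n m hnm).antisymm ?_⟩,
    ⟨fun h M hM => h ▸ hM.1, fun h => ?_⟩⟩
  · refine length_induct_aux (· ∈ C m) (· ∈ C n) (hfg m) ?_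
    intro M hM ih
    have := hfg m M hM
    rcases subsingleton_or_nontrivial M with hs | hs
    · exact mono 0 n (Nat.zero_le _) (hz M hs)
    by_cases hq : M ∈ quotMin (C m)
    · exact h hq
    have : ∃ L : Submodule A M, L ≠ ⊥ ∧ L ≠ ⊤ ∧ ModuleCat.of A (M ⧸ L) ∈ C m := by
      by_contra hc
      push Not at hc
      exact hq ⟨hM, hs, hc⟩
    obtain ⟨L, h1, h2, h3⟩ := this
    have hl := length_sub_quot_aux M L h1 h2
    have hL := hG1b (ModuleCat.of A L) M (ModuleCat.of A (M ⧸ L)) L.subtype L.mkQ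
      L.injective_subtype L.mkQ_surjective (e1 M L) m m hM h3
    rw [max_eq_left (by omega)] at hL
    exact ext M L (ih _ hL hl.1) (ih _ h3 hl.2)
  · rcases hnm.eq_or_lt with rfl | hlt
    · rfl
    refine (mono n m hnm).antisymm ?_
    refine length_induct_aux (· ∈ C m) (· ∈ C n) (hfg m) ?_
    intro M hM ih
    have := hfg m M hM
    rcases subsingleton_or_nontrivial M with hs | hs
    · exact mono 0 n (Nat.zero_le _) (hz M hs)
    by_cases hq : M ∈ subMin (C m)
    · exact h hq
    have : ∃ L : Submodule A M, L ≠ ⊥ ∧ L ≠ ⊤ ∧ ModuleCat.of A L ∈ C m := by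
      by_contra hc
      push Not at hc
      exact hq ⟨hM, hs, hc⟩
    obtain ⟨L, h1, h2, h3⟩ := this
    have hl := length_sub_quot_aux M L h1 h2
    have hL := ih _ h3 hl.1
    have hQ := hG1a (ModuleCat.of A L) M (ModuleCat.of A (M ⧸ L)) L.subtype L.mkQ
      L.injective_subtype L.mkQ_surjective (e1 M L) n m hL hM
    rw [max_eq_right (by omega)] at hQ
    exact ext M L hL (ih _ hQ hl.2)
end

section
/- For an artinian algebra A and n ≥ 0, fin.dim A ≤ n if and only if every module in (P^{≤ n+1})̲ has projective dimension at most n, where P^{≤ k} denotes the class of finitely generated modules of projective dimension at most k. -/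
open CategoryTheory

variable {A : Type} [Ring A]

/-- The projective dimension of a module, defined via vanishing of `Ext`:
`pd M = inf {k : Ext^{k+1}(M, –) = 0}` (and `⊤` if no such `k` exists). -/
noncomputable def pd (M : ModuleCat A) : ℕ∞ :=
  sInf {n : ℕ∞ | ∃ k : ℕ, n = (k : ℕ∞) ∧ ∀ N : ModuleCat A,
    Subsingleton (((Ext ℤ (ModuleCat A) (k+1)).obj (Opposite.op M)).obj N)}

/-- `P^{≤ k}`: the finitely generated modules of projective dimension at most `k`. -/
def Ple (k : ℕ) : Set (ModuleCat A) :=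
  {M | Module.Finite A M ∧ pd M ≤ (k : ℕ∞)}

theorem bridge_ext (M N : ModuleCat A) (k : ℕ) :
    Subsingleton (((Ext ℤ (ModuleCat A) (k+1)).obj (Opposite.op M)).obj N) ↔
    Subsingleton (Abelian.Ext M N (k+1)) := by
  let P := ProjectiveResolution.of M
  rw [← ModuleCat.isZero_iff_subsingleton, (P.isoExt (R := ℤ) (k+1) N).isZero_iff,
    ← HomologicalComplex.exactAt_iff_isZero_homology,
    HomologicalComplex.exactAt_iff' _ k (k+1) (k+2) (by simp) (by simp),
    ShortComplex.moduleCat_exact_iff]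
  constructor
  · intro h
    refine ⟨fun a b => ?_⟩
    suffices H : ∀ a : Abelian.Ext M N (k+1), a = 0 by rw [H a, H b]
    intro a
    obtain ⟨f, hf, rfl⟩ := P.extMk_surjective a (k+2) rfl
    rw [P.extMk_eq_zero_iff _ _ _ _ k rfl]
    exact h f hf
  · intro h f hf
    exact (P.extMk_eq_zero_iff f (k+2) rfl hf k rfl).1 (Subsingleton.elim _ _)

theorem pd_le_iff_lt (M : ModuleCat A) (k : ℕ) :
    pd M ≤ (k : ℕ∞) ↔ HasProjectiveDimensionLT M (k+1) := by
  constructor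
  · intro h
    have hne : {n : ℕ∞ | ∃ k : ℕ, n = (k : ℕ∞) ∧ ∀ N : ModuleCat A,
        Subsingleton (((Ext ℤ (ModuleCat A) (k+1)).obj (Opposite.op M)).obj N)}.Nonempty := by
      by_contra hcon
      rw [Set.not_nonempty_iff_eq_empty] at hcon
      rw [pd, hcon, sInf_empty] at h
      simp at h
    obtain ⟨j, hj, hN⟩ := csInf_mem hne
    have hjk : j ≤ k := by
      have h2 : ((j : ℕ) : ℕ∞) ≤ (k : ℕ∞) := by rw [← hj]; exact h
      exact_mod_cast h2
    have := hasProjectiveDimensionLT_of_enoughInjectives M (j+1)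
      (fun N => (bridge_ext M N j).1 (hN N))
    exact hasProjectiveDimensionLT_of_ge M (j+1) (k+1) (by omega)
  · intro h
    refine sInf_le ⟨k, rfl, fun N => (bridge_ext M N k).2 ?_⟩
    exact HasProjectiveDimensionLT.subsingleton M (k+1) (k+1) le_rfl N

/-- A nonzero f.g. module of `P^{≤ k}` contains a submodule lying in `(P^{≤ k})̲`. -/
theorem exists_subMin [IsArtinianRing A] (k : ℕ) (M : ModuleCat.{0} A) [Nontrivial M]
    (hM : M ∈ Ple (A := A) k) :
    ∃ L : Submodule A M, L ≠ ⊥ ∧ ModuleCat.of A L ∈ subMin (Ple (A := A) k) := by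
  have := hM.1
  have htop : ModuleCat.of A (⊤ : Submodule A M) ∈ Ple (A := A) k := by
    refine ⟨inferInstanceAs (Module.Finite A (⊤ : Submodule A M)), ?_⟩
    rw [pd_le_iff_lt]
    have := (pd_le_iff_lt M k).1 hM.2
    exact hasProjectiveDimensionLT_of_iso
      (LinearEquiv.toModuleIso (Submodule.topEquiv (R := A) (M := M))).symm (k+1)
  obtain ⟨L, ⟨hL0, hLP⟩, hmin⟩ := WellFounded.has_min
    (wellFounded_lt (α := Submodule A M))
    {L | L ≠ ⊥ ∧ ModuleCat.of A L ∈ Ple (A := A) k} ⟨⊤, top_ne_bot, htop⟩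
  refine ⟨L, hL0, hLP, Submodule.nontrivial_iff_ne_bot.2 hL0, ?_⟩
  intro (N : Submodule A L) hN0 hNt hNP
  refine hmin (N.map L.subtype) ⟨?_, ?_⟩ ?_
  · intro h
    exact hN0 (Submodule.map_injective_of_injective L.injective_subtype
      (h.trans (Submodule.map_bot L.subtype).symm))
  · have e := Submodule.equivMapOfInjective L.subtype L.injective_subtype N
    have hf : Module.Finite A N := hNP.1
    refine ⟨inferInstanceAs (Module.Finite A (N.map L.subtype)), ?_⟩
    rw [pd_le_iff_lt]
    have h1 := (pd_le_iff_lt _ k).1 hNP.2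
    have h2 : HasProjectiveDimensionLT (ModuleCat.of A N) (k+1) := h1
    exact hasProjectiveDimensionLT_of_iso (LinearEquiv.toModuleIso e) (k+1)
  · refine lt_of_le_of_ne (Submodule.map_subtype_le L N) ?_
    intro h
    apply hNt
    rw [eq_top_iff]
    rintro ⟨x, hx⟩ -
    rw [← h] at hx
    obtain ⟨y, hy, hyx⟩ := hx
    have hxy : y = ⟨x, by rw [← hyx]; exact y.2⟩ := Subtype.ext hyx
    rw [← hxy]
    exact hy

theorem step_down [IsArtinianRing A] (n : ℕ)
    (H : ∀ M ∈ subMin (Ple (A := A) (n+1)), pd M ≤ (n : ℕ∞))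
    (M : ModuleCat.{0} A) [Module.Finite A M] (hM : HasProjectiveDimensionLT M (n+2)) :
    HasProjectiveDimensionLT M (n+1) := by
  obtain ⟨K, hK, hmax⟩ := WellFounded.has_min
    (wellFounded_gt (α := Submodule A M))
    {K | HasProjectiveDimensionLT (ModuleCat.of A K) (n+1)}
    ⟨⊥, by
      have hz : Limits.IsZero (ModuleCat.of A (⊥ : Submodule A M)) := by
        rw [ModuleCat.isZero_iff_subsingleton]
        exact inferInstanceAs (Subsingleton (⊥ : Submodule A M))
      have := hz.hasProjectiveDimensionLT_zero
      exact hasProjectiveDimensionLT_of_ge _ 0 (n+1) (by omega)⟩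
  have hK : HasProjectiveDimensionLT (ModuleCat.of A K) (n+1) := hK
  by_cases hKt : K = ⊤
  · subst hKt
    exact hasProjectiveDimensionLT_of_iso
      (LinearEquiv.toModuleIso (Submodule.topEquiv (R := A) (M := M))) (n+1)
  exfalso
  have hQ : HasProjectiveDimensionLT (ModuleCat.of A (M ⧸ K)) (n+2) := by
    let S := ModuleCat.shortComplexOfCompEqZero K.subtype K.mkQ (by ext; simp)
    have hS : S.ShortExact := ModuleCat.shortComplex_shortExact S
      (LinearMap.exact_subtype_mkQ K) K.injective_subtype K.mkQ_surjective
    exact hS.hasProjectiveDimensionLT_X₃ (n+1) hK hM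
  have : Nontrivial (ModuleCat.of A (M ⧸ K)) := Submodule.Quotient.nontrivial_iff.2 hKt
  obtain ⟨L, hL0, hL⟩ := exists_subMin (n+1) (ModuleCat.of A (M ⧸ K))
    ⟨inferInstanceAs (Module.Finite A (M ⧸ K)), (pd_le_iff_lt _ _).2 hQ⟩
  have hLn := (pd_le_iff_lt _ _).1 (H _ hL)
  let L₀ : Submodule A (M ⧸ K) := L
  have hKL : K ≤ L₀.comap K.mkQ := by
    intro x hx
    simp [(Submodule.Quotient.mk_eq_zero K).2 hx]
  let g : L₀.comap K.mkQ →ₗ[A] L₀ := K.mkQ.restrict (fun x hx => hx)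
  refine hmax (L₀.comap K.mkQ) ?_ (lt_of_le_of_ne hKL ?_)
  · have hexact : Function.Exact (Submodule.inclusion hKL) g := by
      rintro ⟨x, hx⟩
      constructor
      · intro h
        have h1 : K.mkQ x = 0 := congrArg Subtype.val h
        exact ⟨⟨x, (Submodule.Quotient.mk_eq_zero K).1 h1⟩, rfl⟩
      · rintro ⟨y, hy⟩
        have hxy : (y : M) = x := congrArg Subtype.val hy
        apply Subtype.ext
        change K.mkQ x = 0
        rw [← hxy]
        exact (Submodule.Quotient.mk_eq_zero K).2 y.2
    let S := ModuleCat.shortComplexOfCompEqZero (Submodule.inclusion hKL) g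
      hexact.linearMap_comp_eq_zero
    have hS : S.ShortExact := ModuleCat.shortComplex_shortExact S hexact
      (Submodule.inclusion_injective hKL) (by
        rintro ⟨y, hy⟩
        obtain ⟨x, rfl⟩ := K.mkQ_surjective y
        exact ⟨⟨x, hy⟩, rfl⟩)
    exact hS.hasProjectiveDimensionLT_X₂ (n+1) hK hLn
  · intro h
    apply hL0
    change L₀ = ⊥
    rw [eq_bot_iff]
    intro y hy
    obtain ⟨x, rfl⟩ := K.mkQ_surjective y
    have hx : x ∈ L₀.comap K.mkQ := hy
    rw [← h] at hx
    exact (Submodule.Quotient.mk_eq_zero K).2 hx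

theorem all_down [IsArtinianRing A] (n : ℕ)
    (H : ∀ M ∈ subMin (Ple (A := A) (n+1)), pd M ≤ (n : ℕ∞)) (k : ℕ) :
    ∀ (M : ModuleCat.{0} A) [Module.Finite A M], HasProjectiveDimensionLT M (n+1+k) →
    HasProjectiveDimensionLT M (n+1) := by
  induction k with
  | zero => intro M _ h; exact h
  | succ k ih =>
    intro M _ h
    obtain ⟨m, f, hf⟩ := Module.Finite.exists_fin' A M
    have hS := LinearMap.shortExact_shortComplexKer hf
    have hP : Projective (ModuleCat.of A (Fin m → A)) :=
      ModuleCat.projective_of_free (Pi.basisFun A (Fin m))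
    have h1 := hS.hasProjectiveDimensionLT_X₁ (n+1+k)
      (hasProjectiveDimensionLT_of_ge (ModuleCat.of A (Fin m → A)) 1 _ (by omega)) h
    have hfin : Module.Finite A (ModuleCat.of A (LinearMap.ker f)) :=
      inferInstanceAs (Module.Finite A (LinearMap.ker f))
    have h2 := ih (ModuleCat.of A (LinearMap.ker f)) h1
    exact step_down n H M (hS.hasProjectiveDimensionLT_X₃ (n+1) h2
      (hasProjectiveDimensionLT_of_ge (ModuleCat.of A (Fin m → A)) 1 _ (by omega)))

/-- For an artinian algebra `A` and `n ≥ 0`: `fin.dim A ≤ n` if and only if every module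
in `(P^{≤ n+1})̲` has projective dimension at most `n`. -/
theorem stmt_17 [IsArtinianRing A] (n : ℕ) :
    (⨆ M ∈ {M : ModuleCat A | Module.Finite A M ∧ pd M ≠ ⊤}, pd M) ≤ (n : ℕ∞)
      ↔ ∀ M ∈ subMin (Ple (A := A) (n+1)), pd M ≤ (n : ℕ∞) := by
  constructor
  · intro h M hM
    refine le_trans ?_ h
    refine le_iSup₂_of_le M ⟨hM.1.1, ?_⟩ le_rfl
    exact ne_top_of_le_ne_top (ENat.natCast_ne_top (n+1)) hM.1.2
  · intro H
    refine iSup₂_le ?_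
    rintro M ⟨hfin, hM⟩
    obtain ⟨k, hk⟩ := ENat.ne_top_iff_exists.1 hM
    have h1 := (pd_le_iff_lt M k).1 hk.ge
    rw [pd_le_iff_lt]
    exact all_down n H k M (hasProjectiveDimensionLT_of_ge M (k+1) _ (by omega))
end
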